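/- Let Σ ∈ ℝ^{d_in×d_in} be symmetric positive semidefinite with rank(Σ) ≤ r, Δ ∈ ℝ^{d_out×d_in}, and let Q ∈ ℝ^{r×d_in} be any matrix with Q Σ Qᵀ invertible. Let μ be the Haar probability measure on O(d_out) and U(O) the first r columns of O. Then the expected optimal frozen-B loss exceeds the optimal frozen-A loss by exactly ∫ L(U(O)ᵀΔ, U(O)) dμ(O) − L(Q, B*) = (1 − r/d_out) Tr[Δ Σ Δᵀ] ≥ 0, where B* = Δ Σ Qᵀ (Q Σ Qᵀ)^{-1}. -/

import Mathlib

open Matrix MeasureTheory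

local instance (m n : Type*) : MeasurableSpace (Matrix m n ℝ) := by
  unfold Matrix; infer_instance

/-- The first `r` columns of a `d × d` orthogonal matrix. -/
def firstCols (d r : ℕ) (hrd : r ≤ d) (O : Matrix.orthogonalGroup (Fin d) ℝ) :
    Matrix (Fin d) (Fin r) ℝ :=
  (O : Matrix (Fin d) (Fin d) ℝ).submatrix id (Fin.castLE hrd)

lemma measurable_orthogonalGroup_apply {d : ℕ} (i j : Fin d) :
    Measurable fun O : Matrix.orthogonalGroup (Fin d) ℝ => (O : Matrix (Fin d) (Fin d) ℝ) i j :=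
  (measurable_pi_apply j).comp ((measurable_pi_apply i).comp measurable_subtype_coe)

instance (d : ℕ) : MeasurableMul (Matrix.orthogonalGroup (Fin d) ℝ) where
  measurable_const_mul g := by
    refine Measurable.subtype_mk (measurable_pi_iff.2 fun i => measurable_pi_iff.2 fun j => ?_)
    simp only [Matrix.mul_apply]
    exact Finset.measurable_sum _ fun k _ =>
      (measurable_orthogonalGroup_apply k j).const_mul _
  measurable_mul_const g := by
    refine Measurable.subtype_mk (measurable_pi_iff.2 fun i => measurable_pi_iff.2 fun j => ?_)
    simp only [Matrix.mul_apply]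
    exact Finset.measurable_sum _ fun k _ =>
      (measurable_orthogonalGroup_apply i k).mul_const _

lemma integrable_orthogonalGroup_apply_mul {d : ℕ}
    (μ : Measure (Matrix.orthogonalGroup (Fin d) ℝ)) [IsFiniteMeasure μ] (i j k l : Fin d) :
    Integrable (fun O : Matrix.orthogonalGroup (Fin d) ℝ =>
      (O : Matrix (Fin d) (Fin d) ℝ) i j * (O : Matrix (Fin d) (Fin d) ℝ) k l) μ := by
  refine Integrable.of_bound ((measurable_orthogonalGroup_apply i j).mul
    (measurable_orthogonalGroup_apply k l)).aestronglyMeasurable 1 (.of_forall fun O => ?_)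
  rw [norm_mul]
  exact mul_le_one₀ (entry_norm_bound_of_unitary O.2 i j) (norm_nonneg _)
    (entry_norm_bound_of_unitary O.2 k l)

lemma sum_sq_col_orthogonalGroup {d : ℕ} (O : Matrix.orthogonalGroup (Fin d) ℝ)
    (a : Fin d) : ∑ i, (O : Matrix (Fin d) (Fin d) ℝ) i a * (O : Matrix (Fin d) (Fin d) ℝ) i a
      = 1 := by
  have h := congrFun₂ ((Matrix.mem_orthogonalGroup_iff' (Fin d) ℝ).1 O.2) a a
  simpa [Matrix.mul_apply, Matrix.star_apply] using h

/-- Second moments of a column of a left-invariant random orthogonal matrix. -/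
lemma integral_orthogonalGroup_col_mul {d : ℕ}
    (μ : Measure (Matrix.orthogonalGroup (Fin d) ℝ)) [IsProbabilityMeasure μ]
    [μ.IsMulLeftInvariant] (i j a : Fin d) :
    ∫ O, (O : Matrix (Fin d) (Fin d) ℝ) i a * (O : Matrix (Fin d) (Fin d) ℝ) j a ∂μ
      = if i = j then (d : ℝ)⁻¹ else 0 := by
  split_ifs with hij
  · subst hij
    have hperm (k : Fin d) :
        ∫ O, (O : Matrix (Fin d) (Fin d) ℝ) k a * (O : Matrix (Fin d) (Fin d) ℝ) k a ∂μ
          = ∫ O, (O : Matrix (Fin d) (Fin d) ℝ) i a * (O : Matrix (Fin d) (Fin d) ℝ) i a ∂μ := by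
      let e := Equiv.swap i k
      let g : Matrix.orthogonalGroup (Fin d) ℝ :=
        ⟨(1 : Matrix (Fin d) (Fin d) ℝ).submatrix e id, by
          rw [Matrix.mem_orthogonalGroup_iff, Matrix.transpose_submatrix, Matrix.transpose_one,
            ← Matrix.submatrix_mul _ _ _ id _ Function.bijective_id, Matrix.one_mul,
            Matrix.submatrix_one_equiv]⟩
      rw [← integral_mul_left_eq_self _ g]
      refine integral_congr_ae (.of_forall fun O => ?_)
      simp [g, e, Matrix.mul_apply, Matrix.one_apply]
    have hsum : ∑ k, ∫ O, (O : Matrix (Fin d) (Fin d) ℝ) k a *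
        (O : Matrix (Fin d) (Fin d) ℝ) k a ∂μ = 1 := by
      rw [← integral_finsetSum _ fun k _ => integrable_orthogonalGroup_apply_mul μ k a k a]
      simp [sum_sq_col_orthogonalGroup]
    simp only [hperm, Finset.sum_const, Finset.card_univ, Fintype.card_fin, nsmul_eq_mul] at hsum
    exact eq_inv_of_mul_eq_one_right hsum
  · let g : Matrix.orthogonalGroup (Fin d) ℝ :=
      ⟨Matrix.diagonal fun k => if k = i then -1 else 1, by
        rw [Matrix.mem_orthogonalGroup_iff, Matrix.diagonal_transpose, Matrix.diagonal_mul_diagonal, ← Matrix.diagonal_one]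
        congr 1
        ext k
        by_cases hk : k = i <;> simp [hk]⟩
    have hneg := integral_mul_left_eq_self (μ := μ)
      (fun O => (O : Matrix (Fin d) (Fin d) ℝ) i a * (O : Matrix (Fin d) (Fin d) ℝ) j a) g
    simp only [g, Submonoid.coe_mul, Matrix.diagonal_mul, if_true, if_neg (Ne.symm hij),
      neg_mul, one_mul, integral_neg] at hneg
    linarith

lemma transpose_firstCols_mul_self {d r : ℕ} (hrd : r ≤ d)
    (O : Matrix.orthogonalGroup (Fin d) ℝ) :
    (firstCols d r hrd O)ᵀ * firstCols d r hrd O = 1 := by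
  have h : (O : Matrix (Fin d) (Fin d) ℝ)ᵀ * (O : Matrix (Fin d) (Fin d) ℝ) = 1 :=
    (Matrix.mem_orthogonalGroup_iff' (Fin d) ℝ).1 O.2
  rw [firstCols, Matrix.transpose_submatrix,
    ← Matrix.submatrix_mul _ _ _ id _ Function.bijective_id, h,
    Matrix.submatrix_one _ (Fin.castLE_injective hrd)]

/-- Projecting away the range of a matrix with orthonormal columns. -/
lemma trace_sub_proj_mul_mul_transpose {m n k : Type*} [Fintype m] [Fintype n] [Fintype k]
    [DecidableEq k] (U : Matrix m k ℝ) (hU : Uᵀ * U = 1) (Δ : Matrix m n ℝ) (S : Matrix n n ℝ) :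
    ((Δ - U * (Uᵀ * Δ)) * S * (Δ - U * (Uᵀ * Δ))ᵀ).trace
      = (Δ * S * Δᵀ).trace - (U * Uᵀ * (Δ * S * Δᵀ)).trace := by
  have h1 : (U * (Uᵀ * Δ) * S * (U * (Uᵀ * Δ))ᵀ).trace = (U * Uᵀ * (Δ * S * Δᵀ)).trace := by
    calc (U * (Uᵀ * Δ) * S * (U * (Uᵀ * Δ))ᵀ).trace
        = (U * (Uᵀ * (Δ * S * Δᵀ) * U * Uᵀ)).trace := by
          simp only [Matrix.transpose_mul, Matrix.transpose_transpose, Matrix.mul_assoc]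
      _ = (Uᵀ * (Δ * S * Δᵀ) * U * (Uᵀ * U)).trace := by
          rw [Matrix.trace_mul_comm]
          simp only [Matrix.mul_assoc]
      _ = (U * Uᵀ * (Δ * S * Δᵀ)).trace := by
          rw [hU, Matrix.mul_one, Matrix.trace_mul_comm, ← Matrix.mul_assoc]
  have h2 : (Δ * S * (U * (Uᵀ * Δ))ᵀ).trace = (U * Uᵀ * (Δ * S * Δᵀ)).trace := by
    rw [Matrix.trace_mul_comm (U * Uᵀ)]
    simp only [Matrix.transpose_mul, Matrix.transpose_transpose, Matrix.mul_assoc]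
  have h3 : (U * (Uᵀ * Δ) * S * Δᵀ).trace = (U * Uᵀ * (Δ * S * Δᵀ)).trace := by
    simp only [Matrix.mul_assoc]
  rw [Matrix.transpose_sub, Matrix.mul_sub, Matrix.sub_mul, Matrix.sub_mul, Matrix.sub_mul,
    Matrix.trace_sub, Matrix.trace_sub, Matrix.trace_sub, h1, h2, h3]
  ring

/-- If `S` has rank at most `r` and the `r × r` compression `Q S Qᵀ` is invertible, the
generalized Schur complement of `Q S Qᵀ` vanishes. -/
lemma mul_transpose_mul_inv_mul_mul_eq_self {n k : Type*} [Fintype n] [Fintype k]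
    [DecidableEq n] [DecidableEq k] (S : Matrix n n ℝ) (Q : Matrix k n ℝ)
    (hS : S.rank ≤ Fintype.card k) (hQ : IsUnit (Q * S * Qᵀ)) :
    S * Qᵀ * (Q * S * Qᵀ)⁻¹ * Q * S = S := by
  have hle : LinearMap.range (S * Qᵀ).mulVecLin ≤ LinearMap.range S.mulVecLin := by
    rw [Matrix.mulVecLin_mul]
    exact LinearMap.range_comp_le_range _ _
  have hcard : Fintype.card k ≤ (S * Qᵀ).rank := by
    rw [← Matrix.rank_of_isUnit _ hQ, Matrix.mul_assoc]
    exact Matrix.rank_mul_le_right _ _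
  have heq := Submodule.eq_of_le_of_finrank_le hle (hS.trans hcard)
  have hX (j : n) : ∃ x, (S * Qᵀ) *ᵥ x = S.col j := by
    have : S.col j ∈ LinearMap.range (S * Qᵀ).mulVecLin := by
      rw [heq]
      exact ⟨Pi.single j 1, by simp⟩
    exact this
  choose x hx using hX
  have hSX : S * Qᵀ * (Matrix.of x)ᵀ = S := by
    ext i j
    exact congrFun (hx j) i
  have hdet := (Matrix.isUnit_iff_isUnit_det _).1 hQ
  calc S * Qᵀ * (Q * S * Qᵀ)⁻¹ * Q * S
      = S * Qᵀ * (Q * S * Qᵀ)⁻¹ * Q * (S * Qᵀ * (Matrix.of x)ᵀ) := by rw [hSX]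
    _ = S * Qᵀ * ((Q * S * Qᵀ)⁻¹ * (Q * S * Qᵀ)) * (Matrix.of x)ᵀ := by
        simp only [Matrix.mul_assoc]
    _ = S := by rw [Matrix.nonsing_inv_mul _ hdet, Matrix.mul_one, hSX]

/-- A Haar-random rank-`r` projection is `r / d` times the identity in expectation. -/
lemma integral_trace_firstCols_mul {d r : ℕ} (hrd : r ≤ d)
    (μ : Measure (Matrix.orthogonalGroup (Fin d) ℝ)) [IsProbabilityMeasure μ]
    [μ.IsMulLeftInvariant] (M : Matrix (Fin d) (Fin d) ℝ) :
    Integrable (fun O => (firstCols d r hrd O * (firstCols d r hrd O)ᵀ * M).trace) μ ∧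
    ∫ O, (firstCols d r hrd O * (firstCols d r hrd O)ᵀ * M).trace ∂μ
      = (r : ℝ) / d * M.trace := by
  have hexp (O : Matrix.orthogonalGroup (Fin d) ℝ) :
      (firstCols d r hrd O * (firstCols d r hrd O)ᵀ * M).trace
        = ∑ i, ∑ j, ∑ a : Fin r, (O : Matrix (Fin d) (Fin d) ℝ) i (Fin.castLE hrd a) *
            (O : Matrix (Fin d) (Fin d) ℝ) j (Fin.castLE hrd a) * M j i := by
    simp [Matrix.trace, Matrix.mul_apply, firstCols, Finset.sum_mul]
  have hint (i j : Fin d) (a : Fin r) :=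
    (integrable_orthogonalGroup_apply_mul μ i (Fin.castLE hrd a) j (Fin.castLE hrd a)).mul_const
      (M j i)
  simp only [hexp]
  refine ⟨integrable_finsetSum _ fun i _ => integrable_finsetSum _ fun j _ =>
    integrable_finsetSum _ fun a _ => hint i j a, ?_⟩
  rw [integral_finsetSum _ fun i _ => integrable_finsetSum _ fun j _ =>
    integrable_finsetSum _ fun a _ => hint i j a]
  simp_rw [integral_finsetSum _ fun j _ => integrable_finsetSum _ fun a _ => hint _ j a,
    integral_finsetSum _ fun a _ => hint _ _ a, integral_mul_const,
    integral_orthogonalGroup_col_mul]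
  simp [Matrix.trace, Finset.mul_sum, div_eq_mul_inv, mul_assoc]

/-- **In-expectation form of Theorem 4.3 (A/B asymmetry), rank-≤-r input covariance.**
When `rank(Σ) ≤ r`, the expected optimal frozen-`B` loss (Haar-random orthonormal
`U`, optimal `A* = UᵀΔ`) exceeds the optimal frozen-`A` loss `L(Q, B*)` by exactly
`(1 − r/d_out) Tr[Δ Σ Δᵀ] ≥ 0`, where `B* = Δ Σ Qᵀ (Q Σ Qᵀ)⁻¹` and
`L(A, B) = d_out σ² + Tr[(Δ − BA) Σ (Δ − BA)ᵀ]`. -/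
theorem expected_asymmetry_gap
    (d_in d_out r : ℕ) (hr : 1 ≤ r) (hrd : r ≤ d_out) (hrd' : r ≤ d_in)
    (σ : ℝ) (hσ : 0 ≤ σ)
    (Sig : Matrix (Fin d_in) (Fin d_in) ℝ) (hSig : Sig.PosSemidef)
    (hrank : Sig.rank ≤ r)
    (Δ : Matrix (Fin d_out) (Fin d_in) ℝ)
    (Q : Matrix (Fin r) (Fin d_in) ℝ) (hQ : IsUnit (Q * Sig * Qᵀ))
    (Bstar : Matrix (Fin d_out) (Fin r) ℝ)
    (hBstar : Bstar = Δ * Sig * Qᵀ * (Q * Sig * Qᵀ)⁻¹)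
    (μ : Measure (Matrix.orthogonalGroup (Fin d_out) ℝ))
    [IsProbabilityMeasure μ] [μ.IsHaarMeasure] :
    (∫ O, (d_out * σ ^ 2 +
        ((Δ - firstCols d_out r hrd O * ((firstCols d_out r hrd O)ᵀ * Δ)) * Sig *
          (Δ - firstCols d_out r hrd O * ((firstCols d_out r hrd O)ᵀ * Δ))ᵀ).trace) ∂μ)
      - (d_out * σ ^ 2 + ((Δ - Bstar * Q) * Sig * (Δ - Bstar * Q)ᵀ).trace)
      = (1 - (r : ℝ) / d_out) * (Δ * Sig * Δᵀ).trace ∧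
    0 ≤ (1 - (r : ℝ) / d_out) * (Δ * Sig * Δᵀ).trace := by
  have hopt : (Δ - Bstar * Q) * Sig = 0 := by
    have h := mul_transpose_mul_inv_mul_mul_eq_self Sig Q (by simpa using hrank) hQ
    rw [Matrix.sub_mul, hBstar, sub_eq_zero]
    nth_rewrite 1 [← h]
    simp only [Matrix.mul_assoc]
  obtain ⟨hint, hval⟩ := integral_trace_firstCols_mul hrd μ (Δ * Sig * Δᵀ)
  constructor
  · simp_rw [trace_sub_proj_mul_mul_transpose _ (transpose_firstCols_mul_self hrd _), hopt]
    have hsub := (integrable_const (μ := μ) (Δ * Sig * Δᵀ).trace).sub hint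
    simp only [Pi.sub_def] at hsub
    rw [integral_add (integrable_const _) hsub,
      integral_sub (integrable_const _) hint, hval]
    simp
    ring
  · have htrace : 0 ≤ (Δ * Sig * Δᵀ).trace := by
      simpa using (hSig.mul_mul_conjTranspose_same Δ).trace_nonneg
    refine mul_nonneg (sub_nonneg.2 (div_le_one_of_le₀ ?_ (Nat.cast_nonneg _))) htrace
    exact_mod_cast hrd
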